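/- arXiv:2509.20053 — 5 statements merged into one kernel-verified Lean document; each statement's English description precedes it below -/
import Mathlib

section
/- Let R be a ring equipped with an internal ℕ-grading R = ⊕_{i≥0} R_i, and let S be a nonzero R-module equipped with a compatible ℕ-grading S = ⊕_{i≥0} S_i (so R_i·S_j ⊆ S_{i+j}). Assume S is graded-simple, i.e., the only R-submodules N of S satisfying N = ⊕_i (N ∩ S_i) are 0 and S. Then R⁺·S = 0, where R⁺ is the two-sided ideal of R generated by all homogeneous elements of positive degree, and moreover S is a simple module over the degree-zero subring R_0. -/
open DirectSum

/-- The graded submodule of elements whose homogeneous components of degree below `k` vanish. -/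
def gradedTail {R : Type*} [Ring R] (𝒜 : ℕ → AddSubgroup R) [GradedRing 𝒜]
    {S : Type*} [AddCommGroup S] [Module R S] (ℬ : ℕ → AddSubgroup S) [DirectSum.Decomposition ℬ]
    (hcompat : ∀ (i j : ℕ) (r : R) (s : S), r ∈ 𝒜 i → s ∈ ℬ j → r • s ∈ ℬ (i + j))
    (k : ℕ) : Submodule R S where
  carrier := {x | ∀ i < k, ((decompose ℬ x i : ℬ i) : S) = 0}
  zero_mem' := by simp
  add_mem' {x y} hx hy i hi := by simp [decompose_add, hx i hi, hy i hi]
  smul_mem' r x hx i hi := by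
    classical
    induction r using DirectSum.Decomposition.inductionOn 𝒜 with
    | zero => simp
    | add a b ha hb => simp [add_smul, decompose_add, ha, hb]
    | @homogeneous a r =>
      rw [← sum_support_decompose ℬ x, Finset.smul_sum, decompose_sum, DFinsupp.finsetSum_apply,
        AddSubmonoidClass.coe_finsetSum]
      refine Finset.sum_eq_zero fun j _ => ?_
      by_cases hj : j < k
      · simp [hx j hj]
      · exact decompose_of_mem_ne ℬ (hcompat a j r _ r.2 (decompose ℬ x j).2) (by omega)

theorem decompose_mem_gradedTail {R : Type*} [Ring R] (𝒜 : ℕ → AddSubgroup R) [GradedRing 𝒜]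
    {S : Type*} [AddCommGroup S] [Module R S] (ℬ : ℕ → AddSubgroup S) [DirectSum.Decomposition ℬ]
    (hcompat : ∀ (i j : ℕ) (r : R) (s : S), r ∈ 𝒜 i → s ∈ ℬ j → r • s ∈ ℬ (i + j))
    (k : ℕ) {x : S} (hx : x ∈ gradedTail 𝒜 ℬ hcompat k) (i : ℕ) :
    ((decompose ℬ x i : ℬ i) : S) ∈ gradedTail 𝒜 ℬ hcompat k := by
  intro j hj
  by_cases hij : i = j
  · subst hij
    rw [hx i hj]
    simp
  · exact decompose_of_mem_ne ℬ (decompose ℬ x i).2 hij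

/-- A graded-simple module is concentrated in a single degree. -/
theorem exists_forall_mem_of_gradedSimple {R : Type*} [Ring R] (𝒜 : ℕ → AddSubgroup R)
    [GradedRing 𝒜] {S : Type*} [AddCommGroup S] [Module R S] [Nontrivial S]
    (ℬ : ℕ → AddSubgroup S) [DirectSum.Decomposition ℬ]
    (hcompat : ∀ (i j : ℕ) (r : R) (s : S), r ∈ 𝒜 i → s ∈ ℬ j → r • s ∈ ℬ (i + j))
    (hsimple : ∀ N : Submodule R S,
      (∀ x ∈ N, ∀ i : ℕ, ((decompose ℬ x i : ℬ i) : S) ∈ N) → N = ⊥ ∨ N = ⊤) :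
    ∃ k, ∀ x : S, x ∈ ℬ k := by
  classical
  have hT k := hsimple (gradedTail 𝒜 ℬ hcompat k)
    fun x hx i => decompose_mem_gradedTail 𝒜 ℬ hcompat k hx i
  have hex : ∃ n, gradedTail 𝒜 ℬ hcompat n ≠ ⊤ := by
    by_contra! h
    obtain ⟨x, hx⟩ := exists_ne (0 : S)
    apply hx
    rw [← sum_support_decompose ℬ x]
    refine Finset.sum_eq_zero fun i _ => ?_
    have hxi : x ∈ gradedTail 𝒜 ℬ hcompat (i + 1) := h (i + 1) ▸ Submodule.mem_top
    exact hxi i i.lt_succ_self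
  obtain ⟨k, hk⟩ : ∃ k, Nat.find hex = k + 1 := by
    refine Nat.exists_eq_succ_of_ne_zero fun h0 => Nat.find_spec hex ?_
    rw [h0, eq_top_iff]
    intro x _ i hi
    omega
  have htop : gradedTail 𝒜 ℬ hcompat k = ⊤ :=
    not_not.mp (Nat.find_min hex (m := k) (by omega))
  have hbot : gradedTail 𝒜 ℬ hcompat (k + 1) = ⊥ :=
    (hT (k + 1)).resolve_right (hk ▸ Nat.find_spec hex)
  refine ⟨k, fun x => ?_⟩
  have hx : x ∈ gradedTail 𝒜 ℬ hcompat k := htop ▸ Submodule.mem_top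
  rw [← sum_support_decompose ℬ x]
  refine sum_mem fun i _ => ?_
  rcases lt_trichotomy i k with hi | rfl | hi
  · rw [hx i hi]
    exact zero_mem _
  · exact (decompose ℬ x i).2
  · have hmem : ((decompose ℬ x i : ℬ i) : S) ∈ gradedTail 𝒜 ℬ hcompat (k + 1) :=
      fun j hj => decompose_of_mem_ne ℬ (decompose ℬ x i).2 (by omega)
    rw [hbot, Submodule.mem_bot] at hmem
    rw [hmem]
    exact zero_mem _

/-- let `R` be a ring with an internal ℕ-grading `𝒜`, and `S` a nonzero
`R`-module with a compatible ℕ-grading `ℬ` (so `R_i · S_j ⊆ S_{i+j}`).  If `S` is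
graded-simple (the only `R`-submodules `N` with `N = ⊕_i (N ∩ S_i)`, i.e. containing
all homogeneous components of their elements, are `⊥` and `⊤`), then `R⁺ · S = 0`
where `R⁺` is the two-sided ideal generated by the homogeneous elements of positive
degree, and `S` is a simple module over the degree-zero subring `R_0` (every additive
subgroup of `S` stable under multiplication by elements of `R_0` is `⊥` or `⊤`). -/
theorem stmt_0 (R : Type*) [Ring R] (𝒜 : ℕ → AddSubgroup R) [GradedRing 𝒜]
    (S : Type*) [AddCommGroup S] [Module R S] [Nontrivial S]
    (ℬ : ℕ → AddSubgroup S) [DirectSum.Decomposition ℬ]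
    (hcompat : ∀ (i j : ℕ) (r : R) (s : S), r ∈ 𝒜 i → s ∈ ℬ j → r • s ∈ ℬ (i + j))
    (hsimple : ∀ N : Submodule R S,
      (∀ x ∈ N, ∀ i : ℕ, ((DirectSum.decompose ℬ x i : ℬ i) : S) ∈ N) →
      N = ⊥ ∨ N = ⊤) :
    (∀ r ∈ TwoSidedIdeal.span {x : R | ∃ i : ℕ, 0 < i ∧ x ∈ 𝒜 i},
      ∀ s : S, r • s = 0) ∧
    (∀ N : AddSubgroup S, (∀ r ∈ 𝒜 0, ∀ x ∈ N, r • x ∈ N) → N = ⊥ ∨ N = ⊤) := by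
  obtain ⟨k, hk⟩ := exists_forall_mem_of_gradedSimple 𝒜 ℬ hcompat hsimple
  have hpos : ∀ i, 0 < i → ∀ r ∈ 𝒜 i, ∀ s : S, r • s = 0 := fun i hi r hr s => by
    rw [← decompose_of_mem_same ℬ (hk (r • s))]
    exact decompose_of_mem_ne ℬ (hcompat i k r s hr (hk s)) (by omega)
  constructor
  · intro r hr s
    have hle : TwoSidedIdeal.span {x : R | ∃ i : ℕ, 0 < i ∧ x ∈ 𝒜 i} ≤
        TwoSidedIdeal.ker (Module.toAddMonoidEnd R S) := by
      rw [TwoSidedIdeal.span_le]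
      rintro x ⟨i, hi, hx⟩
      rw [SetLike.mem_coe, TwoSidedIdeal.mem_ker]
      ext s
      exact hpos i hi x hx s
    exact DFunLike.congr_fun ((TwoSidedIdeal.mem_ker _).mp (hle hr)) s
  · intro N hN
    let M : Submodule R S :=
      { N with
        smul_mem' := fun r x hx => by
          change x ∈ N at hx
          change r • x ∈ N
          induction r using DirectSum.Decomposition.inductionOn 𝒜 with
          | zero => simp
          | add a b ha hb =>
            rw [add_smul]
            exact add_mem ha hb
          | @homogeneous i r =>
            rcases Nat.eq_zero_or_pos i with rfl | hi
            · exact hN r r.2 x hx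
            · rw [hpos i hi r r.2]
              exact zero_mem N }
    have hM : M = ⊥ ∨ M = ⊤ := hsimple M fun x hx i => by
      by_cases hi : k = i
      · subst hi
        rwa [decompose_of_mem_same ℬ (hk x)]
      · rw [decompose_of_mem_ne ℬ (hk x) hi]
        exact zero_mem M
    exact hM.imp (fun h => congrArg Submodule.toAddSubgroup h)
      fun h => congrArg Submodule.toAddSubgroup h
end

section
/- Let k be a commutative ring, let S and R be (possibly noncommutative) k-algebras, let L be a right S-module, M a right R-module, and N a left (S ⊗_k R)-module. Then there is a k-module isomorphism (L ⊗_k M) ⊗_{S⊗_k R} N ≅ L ⊗_S (M ⊗_R N) sending (l⊗m)⊗n to l⊗(m⊗n). Here L ⊗_k M carries the right (S ⊗_k R)-action (l⊗m)·(s⊗r) = (l·s)⊗(m·r); N is regarded as a left R-module via r ↦ 1⊗r; and M ⊗_R N is a left S-module via s·(m⊗n) = m⊗((s⊗1)·n). -/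
open scoped TensorProduct
open MulOpposite

section

variable (k S R L M N : Type*) [CommRing k] [Ring S] [Ring R]
  [Algebra k S] [Algebra k R]
  [AddCommGroup L] [Module k L] [Module Sᵐᵒᵖ L]
    [SMulCommClass Sᵐᵒᵖ k L] [IsScalarTower k Sᵐᵒᵖ L]
  [AddCommGroup M] [Module k M] [Module Rᵐᵒᵖ M]
    [SMulCommClass Rᵐᵒᵖ k M] [IsScalarTower k Rᵐᵒᵖ M]
  [AddCommGroup N] [Module k N] [Module (S ⊗[k] R) N] [IsScalarTower k (S ⊗[k] R) N]

/-- The balancing relations for `(L ⊗_k M) ⊗_{S ⊗ R} N`: the right `(S ⊗_k R)`-action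
on `L ⊗_k M` is `(l ⊗ m)·(s ⊗ r) = (l·s) ⊗ (m·r)`. -/
noncomputable def rel₁ : Submodule k ((L ⊗[k] M) ⊗[k] N) :=
  Submodule.span k {z | ∃ (l : L) (m : M) (s : S) (r : R) (n : N),
    z = ((op s • l) ⊗ₜ[k] (op r • m)) ⊗ₜ[k] n - (l ⊗ₜ[k] m) ⊗ₜ[k] ((s ⊗ₜ[k] r) • n)}

/-- The balancing relations for `M ⊗_R N`, where `N` is a left `R`-module via
`r ↦ 1 ⊗ r`. -/
noncomputable def rel₂ : Submodule k (M ⊗[k] N) :=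
  Submodule.span k {z | ∃ (m : M) (r : R) (n : N),
    z = (op r • m) ⊗ₜ[k] n - m ⊗ₜ[k] (((1 : S) ⊗ₜ[k] r) • n)}

/-- The balanced tensor product `M ⊗_R N`. -/
noncomputable abbrev MtimesN := (M ⊗[k] N) ⧸ rel₂ k S R M N

/-- The balancing relations for `L ⊗_S (M ⊗_R N)`, where `M ⊗_R N` is a left
`S`-module via `s · (m ⊗ n) = m ⊗ ((s ⊗ 1)·n)`. -/
noncomputable def rel₃ : Submodule k (L ⊗[k] MtimesN k S R M N) :=
  Submodule.span k {z | ∃ (l : L) (s : S) (m : M) (n : N),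
    z = (op s • l) ⊗ₜ[k] Submodule.Quotient.mk (m ⊗ₜ[k] n)
      - l ⊗ₜ[k] Submodule.Quotient.mk (m ⊗ₜ[k] ((s ⊗ₜ[k] (1 : R)) • n))}

/-- The map `(L ⊗_k M) ⊗_{S ⊗ R} N → L ⊗_S (M ⊗_R N)` induced by the associator. -/
noncomputable def balancedAssocHom :
    (((L ⊗[k] M) ⊗[k] N) ⧸ rel₁ k S R L M N) →ₗ[k]
      ((L ⊗[k] MtimesN k S R M N) ⧸ rel₃ k S R L M N) :=
  (rel₁ k S R L M N).liftQ
    ((rel₃ k S R L M N).mkQ ∘ₗ (rel₂ k S R M N).mkQ.lTensor L ∘ₗ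
      (TensorProduct.assoc k L M N).toLinearMap) <| by
    refine Submodule.span_le.2 ?_
    rintro _ ⟨l, m, s, r, n, rfl⟩
    have hr : (Submodule.Quotient.mk ((op r • m) ⊗ₜ[k] n) : MtimesN k S R M N) =
        Submodule.Quotient.mk (m ⊗ₜ[k] (((1 : S) ⊗ₜ[k] r) • n)) :=
      (Submodule.Quotient.eq _).2 (Submodule.subset_span ⟨m, r, n, rfl⟩)
    have hsr : (s ⊗ₜ[k] r) • n = (s ⊗ₜ[k] (1 : R)) • ((1 : S) ⊗ₜ[k] r) • n := by
      rw [smul_smul, Algebra.TensorProduct.tmul_mul_tmul, mul_one, one_mul]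
    simp only [SetLike.mem_coe, LinearMap.mem_ker, map_sub, LinearMap.comp_apply,
      LinearEquiv.coe_coe, TensorProduct.assoc_tmul, LinearMap.lTensor_tmul,
      Submodule.mkQ_apply, hr, hsr]
    rw [sub_eq_zero, Submodule.Quotient.eq]
    exact Submodule.subset_span ⟨l, s, m, _, rfl⟩

/-- The map `L ⊗_S (M ⊗_R N) → (L ⊗_k M) ⊗_{S ⊗ R} N` induced by the inverse associator. -/
noncomputable def balancedAssocInv :
    ((L ⊗[k] MtimesN k S R M N) ⧸ rel₃ k S R L M N) →ₗ[k]
      (((L ⊗[k] M) ⊗[k] N) ⧸ rel₁ k S R L M N) :=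
  (rel₃ k S R L M N).liftQ
    (TensorProduct.lift ((rel₂ k S R M N).liftQ
      (TensorProduct.curry ((rel₁ k S R L M N).mkQ ∘ₗ
        (TensorProduct.assoc k L M N).symm.toLinearMap)).flip (by
          refine Submodule.span_le.2 ?_
          rintro _ ⟨m, r, n, rfl⟩
          rw [SetLike.mem_coe, LinearMap.mem_ker, map_sub, sub_eq_zero]
          ext l
          simp only [LinearMap.flip_apply, TensorProduct.curry_apply, LinearMap.comp_apply,
            LinearEquiv.coe_coe, TensorProduct.assoc_symm_tmul, Submodule.mkQ_apply]
          rw [Submodule.Quotient.eq]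
          exact Submodule.subset_span ⟨l, m, 1, r, n, by rw [op_one, one_smul]⟩)).flip) <| by
    refine Submodule.span_le.2 ?_
    rintro _ ⟨l, s, m, n, rfl⟩
    rw [SetLike.mem_coe, LinearMap.mem_ker, map_sub, sub_eq_zero]
    exact (Submodule.Quotient.eq (rel₁ k S R L M N)).2
      (Submodule.subset_span ⟨l, m, s, 1, n, by rw [op_one, one_smul]; rfl⟩)

/-- let `k` be a commutative ring, `S`, `R` two `k`-algebras, `L` a right
`S`-module, `M` a right `R`-module and `N` a left `(S ⊗_k R)`-module.  Then there is a
`k`-module isomorphism `(L ⊗_k M) ⊗_{S ⊗_k R} N ≅ L ⊗_S (M ⊗_R N)` sending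
`(l ⊗ m) ⊗ n` to `l ⊗ (m ⊗ n)`, where the balanced tensor products are realized as
quotients of the tensor products over `k` by the balancing relations. -/
theorem stmt_1 :
    ∃ e : (((L ⊗[k] M) ⊗[k] N) ⧸ rel₁ k S R L M N) ≃ₗ[k]
        ((L ⊗[k] MtimesN k S R M N) ⧸ rel₃ k S R L M N),
      ∀ (l : L) (m : M) (n : N),
        e (Submodule.Quotient.mk ((l ⊗ₜ[k] m) ⊗ₜ[k] n))
          = Submodule.Quotient.mk (l ⊗ₜ[k] Submodule.Quotient.mk (m ⊗ₜ[k] n)) := by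
  refine ⟨LinearEquiv.ofLinearMap (balancedAssocHom k S R L M N) (balancedAssocInv k S R L M N)
    ?_ ?_, fun _ _ _ => rfl⟩
  · ext l m n
    rfl
  · ext l m n
    rfl

end
end

section
/- Let k be a field and n ≥ 1. Then the quotient ring k[x_1,…,x_n]/I_n is a finite-dimensional k-vector space of dimension exactly n!. -/
open MvPolynomial

open scoped Polynomial in
/-- Every monic polynomial `p` of degree `n` over a commutative ring has a universal splitting
algebra, and this algebra is free of rank `n!`. -/
theorem exists_universalSplittingAlgebra.{u} (n : ℕ) :
    ∀ (A : Type u) [CommRing A] (p : A[X]), p.Monic → p.natDegree = n →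
      ∃ (S : Type u) (_ : CommRing S) (_ : Algebra A S) (x : Fin n → S),
        Nonempty (Module.Basis (Fin n.factorial) A S) ∧
        p.map (algebraMap A S) = ∏ i, (Polynomial.X - Polynomial.C (x i)) ∧
        (∀ (B : Type u) [CommRing B] (f : A →+* B) (y : Fin n → B),
          p.map f = ∏ i, (Polynomial.X - Polynomial.C (y i)) →
            ∃ φ : S →+* B, φ.comp (algebraMap A S) = f ∧ ∀ i, φ (x i) = y i) ∧
        (∀ (B : Type u) [CommRing B] (φ ψ : S →+* B),
          φ.comp (algebraMap A S) = ψ.comp (algebraMap A S) → (∀ i, φ (x i) = ψ (x i)) →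
            φ = ψ) := by
  induction n with
  | zero =>
    intro A _ p hp hn
    have h1 : p = 1 := hp.natDegree_eq_zero.mp hn
    refine ⟨A, inferInstance, inferInstance, Fin.elim0, ?_, ?_, ?_, ?_⟩
    · exact ⟨(Module.Basis.singleton (Fin 1) A)⟩
    · simp [h1]
    · intro B _ f y _
      exact ⟨f, by ext; simp, fun i => i.elim0⟩
    · intro B _ φ ψ h _
      simpa using h
  | succ n ih =>
    intro A _ p hp hn
    let A' := AdjoinRoot p
    let r : A' := AdjoinRoot.root p
    let b := (AdjoinRoot.powerBasis' hp).basis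
    have : Nontrivial A := by
      by_contra h
      rw [not_nontrivial_iff_subsingleton] at h
      simp [Subsingleton.elim p 0] at hn
    have : Nontrivial A' := by
      refine ⟨b ⟨0, by simp [hn]⟩, 0, b.ne_zero _⟩
    let p' := p.map (AdjoinRoot.of p)
    let q := p' /ₘ (Polynomial.X - Polynomial.C r)
    have hq : (Polynomial.X - Polynomial.C r) * q = p' :=
      Polynomial.mul_divByMonic_eq_iff_isRoot.mpr (AdjoinRoot.isRoot_root p)
    have hqm : q.Monic :=
      (Polynomial.monic_X_sub_C r).of_mul_monic_left (by rw [hq]; exact hp.map _)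
    have hqn : q.natDegree = n := by
      have := Polynomial.natDegree_divByMonic p' (Polynomial.monic_X_sub_C r)
      simpa [p', hp.natDegree_map, hn] using this
    obtain ⟨S, _, _, x, ⟨c⟩, hs, hex, huniq⟩ := ih A' q hqm hqn
    let : Algebra A S := ((algebraMap A' S).comp (algebraMap A A')).toAlgebra
    have : IsScalarTower A A' S := IsScalarTower.of_algebraMap_eq' rfl
    have halg : algebraMap A S = (algebraMap A' S).comp (AdjoinRoot.of p) := rfl
    refine ⟨S, inferInstance, inferInstance, Fin.cons (algebraMap A' S r) x, ?_, ?_, ?_, ?_⟩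
    · refine ⟨(b.smulTower c).reindex (Fintype.equivFinOfCardEq ?_)⟩
      simp [hn, Nat.factorial_succ]
    · rw [Fin.prod_univ_succ, halg, ← Polynomial.map_map]
      change p'.map _ = _
      rw [← hq]
      simp [hs]
    · intro B _ f y hy
      have hroot : p.eval₂ f (y 0) = 0 := by
        rw [← Polynomial.eval_map, hy, Fin.prod_univ_succ]
        simp
      let g : A' →+* B := AdjoinRoot.lift f (y 0) hroot
      have hgr : g r = y 0 := AdjoinRoot.lift_root hroot
      have hgf : g.comp (AdjoinRoot.of p) = f := by
        ext a
        exact AdjoinRoot.lift_of hroot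
      obtain ⟨φ, hφ, hφx⟩ := hex B g (fun i => y i.succ) (by
        apply (Polynomial.monic_X_sub_C (y 0)).isRegular.left
        change _ * _ = _ * _
        rw [← Fin.prod_univ_succ (fun i => Polynomial.X - Polynomial.C (y i)), ← hy, ← hgf,
          ← Polynomial.map_map]
        change _ = p'.map g
        rw [← hq]
        simp [hgr])
      refine ⟨φ, by rw [halg, ← RingHom.comp_assoc, hφ, hgf], Fin.cases ?_ ?_⟩
      · rw [Fin.cons_zero, ← hgr, ← hφ]
        rfl
      · simpa using hφx
    · intro B _ φ ψ h hx
      refine huniq B φ ψ (AdjoinRoot.ringHom_ext ?_ ?_) fun i => by simpa using hx i.succ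
      · exact h
      · simpa using hx 0

/-- The elementary symmetric polynomials of the roots of `X ^ n` vanish in positive degree. -/
theorem aeval_esymm_eq_zero_of_prod_eq_X_pow {k S : Type*} [CommRing k] [CommRing S] [Algebra k S]
    {n : ℕ} {x : Fin n → S}
    (h : ∏ i, (Polynomial.X - Polynomial.C (x i)) = Polynomial.X ^ n)
    {j : ℕ} (hj : 0 < j) (hjn : j ≤ n) : aeval x (esymm (Fin n) k j) = 0 := by
  have h' : ((Finset.univ.val.map x).map fun t => Polynomial.X - Polynomial.C t).prod
      = Polynomial.X ^ n := by
    rw [← h, Multiset.map_map]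
    rfl
  have hc := Multiset.prod_X_sub_C_coeff (Finset.univ.val.map x) (k := n - j) (by simp)
  rw [h', Polynomial.coeff_X_pow, if_neg (by omega)] at hc
  have he : (Multiset.card (Finset.univ.val.map x)) - (n - j) = j := by simp; omega
  rw [he] at hc
  rw [aeval_esymm_eq_multiset_esymm]
  have hu : IsUnit ((-1 : S) ^ j) := (isUnit_one.neg).pow j
  exact (hu.mul_right_eq_zero).mp hc.symm

theorem constantCoeff_esymm_of_pos (σ R : Type*) [Fintype σ] [CommSemiring R] {j : ℕ}
    (hj : 0 < j) : constantCoeff (esymm σ R j) = 0 := by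
  rw [esymm, map_sum]
  refine Finset.sum_eq_zero fun t ht => ?_
  rw [map_prod]
  obtain ⟨i, hi⟩ : t.Nonempty := by
    rw [← Finset.card_pos, (Finset.mem_powersetCard.mp ht).2]
    exact hj
  exact Finset.prod_eq_zero hi (constantCoeff_X _ i)

/-- A symmetric polynomial takes the value of its constant term at every point at which the
elementary symmetric polynomials of positive degree vanish. -/
theorem aeval_eq_algebraMap_constantCoeff_of_isSymmetric {k S : Type*} [CommRing k] [CommRing S]
    [Algebra k S] {n : ℕ} {x : Fin n → S}
    (h : ∀ j, 0 < j → j ≤ n → aeval x (esymm (Fin n) k j) = 0)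
    {f : MvPolynomial (Fin n) k} (hf : f.IsSymmetric) :
    aeval x f = algebraMap k S (constantCoeff f) := by
  obtain ⟨g, hg⟩ := esymmAlgHom_fin_surjective k (le_refl n) ⟨f, hf⟩
  have hg' : f = aeval (fun i : Fin n => esymm (Fin n) k (i + 1)) g := by
    rw [← esymmAlgHom_apply, hg]
  suffices (aeval x).toRingHom.comp
      (aeval (R := k) fun i : Fin n => esymm (Fin n) k (i + 1)).toRingHom =
      ((algebraMap k S).comp constantCoeff).comp
        (aeval (R := k) fun i : Fin n => esymm (Fin n) k (i + 1)).toRingHom by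
    rw [hg']
    exact RingHom.congr_fun this g
  apply MvPolynomial.ringHom_ext
  · intro a
    simp
  · intro i
    simp [h _ (Nat.succ_pos _) (Nat.succ_le_of_lt i.is_lt),
      constantCoeff_esymm_of_pos _ _ (Nat.succ_pos _)]

/-- for a field `k` and `n ≥ 1`, the quotient of `k[x_1,…,x_n]` by the ideal
`I_n` generated by symmetric polynomials with zero constant term is a finite-dimensional
`k`-vector space of dimension exactly `n!`. -/
theorem stmt_3 (k : Type*) [Field k] (n : ℕ) (hn : 1 ≤ n)
    (I : Ideal (MvPolynomial (Fin n) k))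
    (hI : I = Ideal.span {f : MvPolynomial (Fin n) k |
        f.IsSymmetric ∧ constantCoeff f = 0}) :
    FiniteDimensional k (MvPolynomial (Fin n) k ⧸ I) ∧
      Module.finrank k (MvPolynomial (Fin n) k ⧸ I) = Nat.factorial n := by
  obtain ⟨S, _, _, x, ⟨b⟩, hs, hex, huniq⟩ :=
    exists_universalSplittingAlgebra n k (Polynomial.X ^ n) (Polynomial.monic_X_pow n) (by simp)
  rw [Polynomial.map_pow, Polynomial.map_X] at hs
  have hIS : ∀ f ∈ I, aeval x f = 0 := by
    suffices I ≤ RingHom.ker (aeval (R := k) x) from fun f hf => this hf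
    rw [hI, Ideal.span_le]
    rintro f ⟨hf, hf0⟩
    change aeval x f = 0
    rw [aeval_eq_algebraMap_constantCoeff_of_isSymmetric
      (fun j => aeval_esymm_eq_zero_of_prod_eq_X_pow hs.symm) hf, hf0, map_zero]
  let ψ : (MvPolynomial (Fin n) k ⧸ I) →ₐ[k] S := Ideal.Quotient.liftₐ I (aeval x) hIS
  let y : Fin n → MvPolynomial (Fin n) k ⧸ I := fun i => Ideal.Quotient.mkₐ k I (X i)
  have hy : aeval y = Ideal.Quotient.mkₐ k I := by
    ext i
    simp [y]
  have hψy : ∀ i, ψ (y i) = x i := fun i => by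
    change aeval x (X i) = _
    simp
  have hprod : ∏ i, (Polynomial.X - Polynomial.C (y i)) = Polynomial.X ^ n := by
    have h0 : ∀ j, 0 < j → j ≤ n → (Finset.univ.val.map y).esymm j = 0 := by
      intro j hj _
      rw [← aeval_esymm_eq_multiset_esymm (Fin n) k, hy, Ideal.Quotient.mkₐ_eq_mk,
        Ideal.Quotient.eq_zero_iff_mem, hI]
      refine Ideal.subset_span ⟨esymm_isSymmetric _ _ _, constantCoeff_esymm_of_pos _ _ hj⟩
    have := Multiset.prod_X_sub_X_eq_sum_esymm (Finset.univ.val.map y)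
    rw [Multiset.map_map] at this
    refine (Eq.trans rfl this).trans ?_
    rw [Finset.sum_range_succ', Finset.sum_eq_zero]
    · simp [Multiset.esymm]
    · intro j hj
      rw [h0 _ (Nat.succ_pos j) (by simpa using hj)]
      simp
  obtain ⟨φ, hφ, hφx⟩ := hex _ (algebraMap k _) y (by simpa using hprod.symm)
  let φ' : S →ₐ[k] (MvPolynomial (Fin n) k ⧸ I) := { φ with commutes' := RingHom.congr_fun hφ }
  have hφx' : ∀ i, φ' (x i) = y i := hφx
  have h1 : ψ.comp φ' = AlgHom.id k S := by
    have := huniq S (ψ.comp φ').toRingHom (AlgHom.id k S).toRingHom (by ext a; simp)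
      (fun i => by simp [hφx', hψy])
    ext a
    exact RingHom.congr_fun this a
  have h2 : φ'.comp ψ = AlgHom.id k _ := by
    apply Ideal.Quotient.algHom_ext
    ext i
    change φ' (ψ (y i)) = y i
    rw [hψy, hφx']
  let e : S ≃ₐ[k] (MvPolynomial (Fin n) k ⧸ I) := AlgEquiv.ofAlgHom φ' ψ h2 h1
  let b' := b.map e.toLinearEquiv
  exact ⟨b'.finiteDimensional_of_finite, by simp [Module.finrank_eq_card_basis b']⟩
end

section
/- Let k be a field and n ≥ 1. There exists a k-algebra homomorphism ρ : NH_n → End_k(k[x_1,…,x_n]) sending the generator x_i to the operator of multiplication by x_i and sending the generator ∂_i to the divided difference operator ∂_i (the polynomial representation of the nilHecke algebra). -/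
open scoped TensorProduct

/-! ## The nilHecke algebra

For a field `k` and `N : ℕ`, the nilHecke algebra `NH k N` is the quotient of the free
associative `k`-algebra on generators `x_0, …, x_{N-1}` (indexed by `Fin N`) and
`∂_0, …, ∂_{N-2}` (indexed by `{i : Fin N // i + 1 < N}`) by the nilHecke relations. -/

/-- Index type for the generators `∂_i` of the nilHecke algebra on `N` strands. -/
abbrev DIdx (N : ℕ) : Type := {i : Fin N // (i : ℕ) + 1 < N}

/-- The generators of the nilHecke algebra: `Sum.inl i` is `x_i`, `Sum.inr j` is `∂_j`. -/
abbrev NHGen (N : ℕ) : Type := Fin N ⊕ DIdx N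

variable (k : Type) [Field k]

/-- `x_i` in the free algebra. -/
noncomputable abbrev NHx (N : ℕ) (i : Fin N) : FreeAlgebra k (NHGen N) :=
  FreeAlgebra.ι k (Sum.inl i)

/-- `∂_i` in the free algebra. -/
noncomputable abbrev NHd (N : ℕ) (i : DIdx N) : FreeAlgebra k (NHGen N) :=
  FreeAlgebra.ι k (Sum.inr i)

/-- For `i` an index of a `∂` generator, the element `i+1` of `Fin N`. -/
abbrev DIdx.succ {N : ℕ} (i : DIdx N) : Fin N := ⟨(i.1 : ℕ) + 1, i.2⟩

/-- The defining relations of the nilHecke algebra: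
`x_i x_j = x_j x_i`; `∂_i² = 0`; `∂_i ∂_{i+1} ∂_i = ∂_{i+1} ∂_i ∂_{i+1}`;
`∂_i ∂_j = ∂_j ∂_i` for `|i-j| > 1`; `x_i ∂_j = ∂_j x_i` for `|i-j| > 1`;
`x_i ∂_i - ∂_i x_{i+1} = 1`; `∂_i x_i - x_{i+1} ∂_i = 1`. -/
inductive NHRel (N : ℕ) : FreeAlgebra k (NHGen N) → FreeAlgebra k (NHGen N) → Prop
  | xcomm (i j : Fin N) : NHRel N (NHx k N i * NHx k N j) (NHx k N j * NHx k N i)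
  | dsq (i : DIdx N) : NHRel N (NHd k N i * NHd k N i) 0
  | braid (i j : DIdx N) (h : (j.1 : ℕ) = (i.1 : ℕ) + 1) :
      NHRel N (NHd k N i * NHd k N j * NHd k N i) (NHd k N j * NHd k N i * NHd k N j)
  | ddfar (i j : DIdx N) (h : (i.1 : ℕ) + 1 < (j.1 : ℕ) ∨ (j.1 : ℕ) + 1 < (i.1 : ℕ)) :
      NHRel N (NHd k N i * NHd k N j) (NHd k N j * NHd k N i)
  | xdfar (i : Fin N) (j : DIdx N)
      (h : (i : ℕ) + 1 < (j.1 : ℕ) ∨ (j.1 : ℕ) + 1 < (i : ℕ)) :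
      NHRel N (NHx k N i * NHd k N j) (NHd k N j * NHx k N i)
  | xd (i : DIdx N) :
      NHRel N (NHx k N i.1 * NHd k N i - NHd k N i * NHx k N i.succ) 1
  | dx (i : DIdx N) :
      NHRel N (NHd k N i * NHx k N i.1 - NHx k N i.succ * NHd k N i) 1

/-- The nilHecke algebra on `N` strands over `k`. -/
noncomputable def NH (N : ℕ) : Type := RingQuot (NHRel k N)

noncomputable instance (N : ℕ) : Ring (NH k N) :=
  inferInstanceAs (Ring (RingQuot (NHRel k N)))

noncomputable instance (N : ℕ) : Algebra k (NH k N) :=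
  inferInstanceAs (Algebra k (RingQuot (NHRel k N)))

/-- The generator `x_i` of the nilHecke algebra `NH k N`. -/
noncomputable def xg (N : ℕ) (i : Fin N) : NH k N :=
  RingQuot.mkAlgHom k (NHRel k N) (NHx k N i)

/-- The generator `∂_i` of the nilHecke algebra `NH k N`. -/
noncomputable def dg (N : ℕ) (i : DIdx N) : NH k N :=
  RingQuot.mkAlgHom k (NHRel k N) (NHd k N i)



open MvPolynomial

section DividedDifference

variable {σ R : Type*} [CommRing R]

theorem X_sub_X_ne_zero [Nontrivial R] {a b : σ} (h : a ≠ b) :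
    (X a - X b : MvPolynomial σ R) ≠ 0 :=
  sub_ne_zero.2 fun e => h (X_injective e)

variable [DecidableEq σ]

theorem X_sub_X_dvd_sub_rename_swap (a b : σ) (f : MvPolynomial σ R) :
    (X a - X b : MvPolynomial σ R) ∣ f - rename (Equiv.swap a b) f := by
  rw [← Ideal.mem_span_singleton, ← Ideal.Quotient.mk_eq_mk_iff_sub_mem]
  set I : Ideal (MvPolynomial σ R) := Ideal.span {X a - X b}
  have hab : Ideal.Quotient.mk I (X a) = Ideal.Quotient.mk I (X b) :=
    (Ideal.Quotient.mk_eq_mk_iff_sub_mem _ _).2 (Ideal.mem_span_singleton_self _)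
  suffices h : Ideal.Quotient.mkₐ R I =
      (Ideal.Quotient.mkₐ R I).comp (rename (Equiv.swap a b)) from DFunLike.congr_fun h f
  ext i
  rcases eq_or_ne i a with rfl | hia
  · simp [hab]
  rcases eq_or_ne i b with rfl | hib
  · simp [hab]
  · simp [Equiv.swap_apply_of_ne_of_ne hia hib]

variable (R) [IsDomain R]

/-- The divided difference operator `f ↦ (f - s f) / (X a - X b)`, where `s` exchanges the
variables `X a` and `X b`. -/
noncomputable def divDiff {a b : σ} (h : a ≠ b) : Module.End R (MvPolynomial σ R) where
  toFun f := (X_sub_X_dvd_sub_rename_swap a b f).choose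
  map_add' f g := by
    apply mul_left_cancel₀ (X_sub_X_ne_zero (R := R) h)
    have hf := (X_sub_X_dvd_sub_rename_swap a b f).choose_spec
    have hg := (X_sub_X_dvd_sub_rename_swap a b g).choose_spec
    have hfg := (X_sub_X_dvd_sub_rename_swap a b (f + g)).choose_spec
    linear_combination hf + hg - hfg - map_add (rename (Equiv.swap a b)) f g
  map_smul' c f := by
    apply mul_left_cancel₀ (X_sub_X_ne_zero (R := R) h)
    rw [RingHom.id_apply, mul_smul_comm, ← (X_sub_X_dvd_sub_rename_swap a b f).choose_spec,
      ← (X_sub_X_dvd_sub_rename_swap a b (c • f)).choose_spec, map_smul, smul_sub]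

variable {R} {a b : σ}

theorem X_sub_X_mul_divDiff (h : a ≠ b) (f : MvPolynomial σ R) :
    (X a - X b) * divDiff R h f = f - rename (Equiv.swap a b) f :=
  (X_sub_X_dvd_sub_rename_swap a b f).choose_spec.symm

theorem rename_swap_divDiff (h : a ≠ b) (f : MvPolynomial σ R) :
    rename (Equiv.swap a b) (divDiff R h f) = divDiff R h f := by
  apply mul_left_cancel₀ (X_sub_X_ne_zero (R := R) h)
  have h₁ := X_sub_X_mul_divDiff h f
  have h₂ := congrArg (rename (Equiv.swap a b)) h₁
  simp only [map_mul, map_sub, rename_X, Equiv.swap_apply_left, Equiv.swap_apply_right,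
    rename_rename, ← Equiv.coe_trans, Equiv.swap_swap, Equiv.coe_refl, rename_id_apply] at h₂
  linear_combination -h₁ - h₂

theorem divDiff_mul_self (h : a ≠ b) : divDiff R h * divDiff R h = 0 := by
  refine LinearMap.ext fun f => ?_
  apply mul_left_cancel₀ (X_sub_X_ne_zero (R := R) h)
  rw [Module.End.mul_apply, X_sub_X_mul_divDiff, rename_swap_divDiff]
  simp

theorem mulLeft_X_mul_divDiff_sub (h : a ≠ b) :
    LinearMap.mulLeft R (X a) * divDiff R h - divDiff R h * LinearMap.mulLeft R (X b) = 1 := by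
  refine LinearMap.ext fun f => ?_
  apply mul_left_cancel₀ (X_sub_X_ne_zero (R := R) h)
  have h₁ := X_sub_X_mul_divDiff h f
  have h₂ := X_sub_X_mul_divDiff h (X b * f)
  simp only [map_mul, rename_X, Equiv.swap_apply_right] at h₂
  simp only [LinearMap.sub_apply, Module.End.mul_apply, LinearMap.mulLeft_apply,
    Module.End.one_apply]
  linear_combination X a * h₁ - h₂

theorem divDiff_mul_mulLeft_X_sub (h : a ≠ b) :
    divDiff R h * LinearMap.mulLeft R (X a) - LinearMap.mulLeft R (X b) * divDiff R h = 1 := by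
  refine LinearMap.ext fun f => ?_
  apply mul_left_cancel₀ (X_sub_X_ne_zero (R := R) h)
  have h₁ := X_sub_X_mul_divDiff h f
  have h₂ := X_sub_X_mul_divDiff h (X a * f)
  simp only [map_mul, rename_X, Equiv.swap_apply_left] at h₂
  simp only [LinearMap.sub_apply, Module.End.mul_apply, LinearMap.mulLeft_apply,
    Module.End.one_apply]
  linear_combination h₂ - X b * h₁

theorem mulLeft_X_mul_divDiff_comm (h : a ≠ b) {c : σ} (hca : c ≠ a) (hcb : c ≠ b) :
    LinearMap.mulLeft R (X c) * divDiff R h = divDiff R h * LinearMap.mulLeft R (X c) := by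
  refine LinearMap.ext fun f => ?_
  apply mul_left_cancel₀ (X_sub_X_ne_zero (R := R) h)
  have h₁ := X_sub_X_mul_divDiff h f
  have h₂ := X_sub_X_mul_divDiff h (X c * f)
  simp only [map_mul, rename_X, Equiv.swap_apply_of_ne_of_ne hca hcb] at h₂
  simp only [Module.End.mul_apply, LinearMap.mulLeft_apply]
  linear_combination X c * h₁ - h₂

theorem X_sub_X_mul_X_sub_X_mul_divDiff_divDiff (h : a ≠ b) {c d : σ} (h' : c ≠ d)
    (hca : c ≠ a) (hcb : c ≠ b) (hda : d ≠ a) (hdb : d ≠ b) (f : MvPolynomial σ R) :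
    (X a - X b) * (X c - X d) * divDiff R h (divDiff R h' f) =
      f - rename (Equiv.swap a b) f - rename (Equiv.swap c d) f
        + rename (Equiv.swap a b) (rename (Equiv.swap c d) f) := by
  have h₁ := X_sub_X_mul_divDiff h (divDiff R h' f)
  have h₂ := X_sub_X_mul_divDiff h' f
  have h₃ := congrArg (rename (Equiv.swap a b)) h₂
  simp only [map_mul, map_sub, rename_X, Equiv.swap_apply_of_ne_of_ne hca hcb,
    Equiv.swap_apply_of_ne_of_ne hda hdb] at h₃
  linear_combination (X c - X d) * h₁ + h₂ - h₃

theorem divDiff_mul_divDiff_comm (h : a ≠ b) {c d : σ} (h' : c ≠ d)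
    (hca : c ≠ a) (hcb : c ≠ b) (hda : d ≠ a) (hdb : d ≠ b) :
    divDiff R h * divDiff R h' = divDiff R h' * divDiff R h := by
  refine LinearMap.ext fun f => ?_
  apply mul_left_cancel₀
    (mul_ne_zero (X_sub_X_ne_zero (R := R) h) (X_sub_X_ne_zero (R := R) h'))
  have h₁ := X_sub_X_mul_X_sub_X_mul_divDiff_divDiff h h' hca hcb hda hdb f
  have h₂ := X_sub_X_mul_X_sub_X_mul_divDiff_divDiff h' h hca.symm hda.symm hcb.symm hdb.symm f
  have hs : rename (Equiv.swap a b) (rename (Equiv.swap c d) f) =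
      rename (Equiv.swap c d) (rename (Equiv.swap a b) f) := by
    have hd : (Equiv.swap a b).Disjoint (Equiv.swap c d) := by
      intro x
      by_cases hxa : x = a
      · subst hxa
        exact .inr (Equiv.swap_apply_of_ne_of_ne hca.symm hda.symm)
      by_cases hxb : x = b
      · subst hxb
        exact .inr (Equiv.swap_apply_of_ne_of_ne hcb.symm hdb.symm)
      exact .inl (Equiv.swap_apply_of_ne_of_ne hxa hxb)
    rw [rename_rename, rename_rename, ← Equiv.Perm.coe_mul, hd.commute.eq, Equiv.Perm.coe_mul]
  simp only [Module.End.mul_apply]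
  linear_combination h₁ - h₂ + hs

theorem mul_mul_mul_braid_eq {S : Type*} [CommRing S] (s t : S →+* S) (d e : S → S) {u v w : S}
    (hd : ∀ f, u * d f = f - s f) (he : ∀ f, v * e f = f - t f) (hsd : ∀ f, s (d f) = d f)
    (hw : w = u + v) (hsv : s v = w) (hsw : s w = v) (htu : t u = w) (f : S) :
    u * v * w * d (e (d f)) = f - s f - t f + t (s f) + s (t f) - s (t (s f)) := by
  have h₁ := hd (e (d f))
  have h₂ := he (d f)
  have h₃ := congrArg s h₂
  have h₄ := hd f
  have h₅ := congrArg t h₄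
  have h₆ := congrArg s h₅
  simp only [map_mul, map_sub, hsv, hsw, htu, hsd] at h₃ h₅ h₆
  linear_combination v * w * h₁ + w * h₂ - v * h₃ + h₄ - h₅ + h₆ + d f * hw

theorem divDiff_braid {c : σ} (hab : a ≠ b) (hbc : b ≠ c) (hac : a ≠ c) :
    divDiff R hab * divDiff R hbc * divDiff R hab =
      divDiff R hbc * divDiff R hab * divDiff R hbc := by
  refine LinearMap.ext fun f => ?_
  apply mul_left_cancel₀ (mul_ne_zero (mul_ne_zero (X_sub_X_ne_zero (R := R) hab)
    (X_sub_X_ne_zero (R := R) hbc)) (X_sub_X_ne_zero (R := R) hac))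
  set s : MvPolynomial σ R →+* MvPolynomial σ R := (rename (Equiv.swap a b)).toRingHom
  set t : MvPolynomial σ R →+* MvPolynomial σ R := (rename (Equiv.swap b c)).toRingHom
  have hsX (i : σ) : s (X i) = X (Equiv.swap a b i) := rename_X _ _
  have htX (i : σ) : t (X i) = X (Equiv.swap b c i) := rename_X _ _
  have hsc : Equiv.swap a b c = c := Equiv.swap_apply_of_ne_of_ne hac.symm hbc.symm
  have hta : Equiv.swap b c a = a := Equiv.swap_apply_of_ne_of_ne hab hac
  have hsv : s (X b - X c) = X a - X c := by simp [hsX, hsc]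
  have hsw : s (X a - X c) = X b - X c := by simp [hsX, hsc]
  have htu : t (X a - X b) = X a - X c := by simp [htX, hta]
  have htw : t (X a - X c) = X a - X b := by simp [htX, hta]
  have h₁ := mul_mul_mul_braid_eq s t _ _ (X_sub_X_mul_divDiff hab) (X_sub_X_mul_divDiff hbc)
    (rename_swap_divDiff hab) (by ring) hsv hsw htu f
  have h₂ := mul_mul_mul_braid_eq t s _ _ (X_sub_X_mul_divDiff hbc) (X_sub_X_mul_divDiff hab)
    (rename_swap_divDiff hbc) (by ring) htu htw hsv f
  have hst : s (t (s f)) = t (s (t f)) := by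
    have hp : Equiv.swap a b * Equiv.swap b c * Equiv.swap a b =
        Equiv.swap b c * Equiv.swap a b * Equiv.swap b c := by
      rw [Equiv.swap_mul_swap_mul_swap hab hac, Equiv.swap_comm a b, Equiv.swap_comm b c,
        Equiv.swap_mul_swap_mul_swap hbc.symm hac.symm, Equiv.swap_comm]
    change rename _ (rename _ (rename _ f)) = rename _ (rename _ (rename _ f))
    simp only [rename_rename, ← Equiv.Perm.coe_mul, ← mul_assoc, hp]
  simp only [Module.End.mul_apply]
  linear_combination h₁ - h₂ - hst

end DividedDifference

theorem DIdx.ne_succ {N : ℕ} (i : DIdx N) : i.1 ≠ i.succ := by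
  simp [Fin.ext_iff]

/-- The images of the nilHecke generators in the polynomial representation. -/
noncomputable def polyRepGen (N : ℕ) : NHGen N → Module.End k (MvPolynomial (Fin N) k)
  | .inl i => LinearMap.mulLeft k (X i)
  | .inr j => divDiff k j.ne_succ

theorem lift_polyRepGen_eq_of_rel {N : ℕ} {p q : FreeAlgebra k (NHGen N)} (h : NHRel k N p q) :
    FreeAlgebra.lift k (polyRepGen k N) p = FreeAlgebra.lift k (polyRepGen k N) q := by
  cases h <;>
    simp only [map_mul, map_sub, map_one, map_zero, FreeAlgebra.lift_ι_apply, polyRepGen]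
  case xcomm i j => rw [Module.End.mul_eq_comp, Module.End.mul_eq_comp, ← LinearMap.mulLeft_mul,
    ← LinearMap.mulLeft_mul, mul_comm]
  case dsq i => exact divDiff_mul_self _
  case braid i j h =>
    obtain ⟨⟨j, hj⟩, hj'⟩ := j
    obtain rfl : j = i.1 + 1 := h
    exact divDiff_braid _ _ (by simp [Fin.ext_iff]; omega)
  case ddfar i j h =>
    apply divDiff_mul_divDiff_comm <;> simp only [ne_eq, Fin.ext_iff] <;> omega
  case xdfar i j h =>
    apply mulLeft_X_mul_divDiff_comm <;> simp only [ne_eq, Fin.ext_iff] <;> omega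
  case xd i => exact mulLeft_X_mul_divDiff_sub _
  case dx i => exact divDiff_mul_mulLeft_X_sub _

/-- The polynomial representation of the nilHecke algebra. -/
noncomputable def polyRep (N : ℕ) : NH k N →ₐ[k] Module.End k (MvPolynomial (Fin N) k) :=
  RingQuot.liftAlgHom k
    ⟨FreeAlgebra.lift k (polyRepGen k N), fun _ _ h => lift_polyRepGen_eq_of_rel k h⟩

theorem polyRep_xg (N : ℕ) (i : Fin N) : polyRep k N (xg k N i) = LinearMap.mulLeft k (X i) :=
  (RingQuot.liftAlgHom_mkAlgHom_apply _ _ _ _).trans (FreeAlgebra.lift_ι_apply _ _)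

theorem polyRep_dg (N : ℕ) (j : DIdx N) : polyRep k N (dg k N j) = divDiff k j.ne_succ :=
  (RingQuot.liftAlgHom_mkAlgHom_apply _ _ _ _).trans (FreeAlgebra.lift_ι_apply _ _)

/-- for a field `k` and `n ≥ 1`, there is a `k`-algebra homomorphism
`ρ : NH_n → End_k(k[x_1,…,x_n])` sending the generator `x_i` to multiplication by `x_i`
and the generator `∂_i` to the divided difference operator (characterized by
`(x_i - x_{i+1}) · ∂_i(f) = f - s_i(f)`): the polynomial representation. -/
theorem stmt_8 (n : ℕ) (hn : 1 ≤ n) :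
    ∃ ρ : NH k n →ₐ[k] Module.End k (MvPolynomial (Fin n) k),
      (∀ i : Fin n, ρ (xg k n i) = LinearMap.mulLeft k (X i)) ∧
      (∀ (j : DIdx n) (f : MvPolynomial (Fin n) k),
        (X j.1 - X j.succ) * (ρ (dg k n j) f)
          = f - rename (Equiv.swap j.1 j.succ) f) := by
  refine ⟨polyRep k n, polyRep_xg k n, fun j f => ?_⟩
  rw [polyRep_dg]
  exact X_sub_X_mul_divDiff _ f
end

section
/- Let k be a field and n ≥ 1. In the nilHecke algebra NH_n, the element e_n := x_1^{n−1} x_2^{n−2} ⋯ x_{n−1} ∂_{w_0} is an idempotent: e_n · e_n = e_n. -/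
open scoped TensorProduct

variable (k : Type) [Field k]

/-- `IsDfam k N Dm` says that `Dm : S_N → NH_N` is the family `w ↦ ∂_w`, defined via
reduced expressions: it is characterized by `∂_1 = 1` together with
`∂_{w s_i} = ∂_w · ∂_i` whenever `ℓ(w s_i) = ℓ(w) + 1`, i.e. whenever `w(i) < w(i+1)`. -/
def IsDfam (N : ℕ) (Dm : Equiv.Perm (Fin N) → NH k N) : Prop :=
  Dm 1 = 1 ∧ ∀ (w : Equiv.Perm (Fin N)) (i : DIdx N),
    w i.1 < w i.succ → Dm (w * Equiv.swap i.1 i.succ) = Dm w * dg k N i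

/-- The element `e_N = x_1^{N-1} x_2^{N-2} ⋯ x_{N-1} ∂_{w_0} ∈ NH_N` (0-indexed:
`x_i` appears with exponent `N-1-i`), where `w_0 = Fin.revPerm` is the longest element
of `S_N` and `Dm = (∂_w)_w` is the family of divided difference elements. -/
noncomputable def eElt (N : ℕ) (Dm : Equiv.Perm (Fin N) → NH k N) : NH k N :=
  (List.ofFn fun i : Fin N => xg k N i ^ (N - 1 - (i : ℕ))).prod * Dm Fin.revPerm

section NilHeckeRelations

variable {k} {N : ℕ}

/-- The quotient map onto the nilHecke algebra. -/
noncomputable def NH.mk : FreeAlgebra k (NHGen N) →ₐ[k] NH k N :=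
  RingQuot.mkAlgHom k (NHRel k N)

theorem NH.mk_eq {a b : FreeAlgebra k (NHGen N)} (h : NHRel k N a b) :
    (NH.mk a : NH k N) = NH.mk b :=
  RingQuot.mkAlgHom_rel k h

theorem NH.mk_NHx (i : Fin N) : NH.mk (NHx k N i) = xg k N i := rfl

theorem NH.mk_NHd (i : DIdx N) : NH.mk (NHd k N i) = dg k N i := rfl

theorem xg_mul_comm (i j : Fin N) : xg k N i * xg k N j = xg k N j * xg k N i := by
  simpa only [map_mul, map_sub, map_one, map_zero, NH.mk_NHx, NH.mk_NHd] using
    NH.mk_eq (NHRel.xcomm (k := k) i j)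

theorem dg_mul_self (i : DIdx N) : dg k N i * dg k N i = 0 := by
  simpa only [map_mul, map_sub, map_one, map_zero, NH.mk_NHx, NH.mk_NHd] using
    NH.mk_eq (NHRel.dsq (k := k) i)

theorem dg_braid (i j : DIdx N) (h : (j.1 : ℕ) = (i.1 : ℕ) + 1) :
    dg k N i * dg k N j * dg k N i = dg k N j * dg k N i * dg k N j := by
  simpa only [map_mul, map_sub, map_one, map_zero, NH.mk_NHx, NH.mk_NHd] using
    NH.mk_eq (NHRel.braid (k := k) i j h)

theorem xg_mul_dg_of_far (i : Fin N) (j : DIdx N)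
    (h : (i : ℕ) + 1 < (j.1 : ℕ) ∨ (j.1 : ℕ) + 1 < (i : ℕ)) :
    xg k N i * dg k N j = dg k N j * xg k N i := by
  simpa only [map_mul, map_sub, map_one, map_zero, NH.mk_NHx, NH.mk_NHd] using
    NH.mk_eq (NHRel.xdfar (k := k) i j h)

theorem xg_mul_dg (i : DIdx N) :
    xg k N i.1 * dg k N i = dg k N i * xg k N i.succ + 1 := by
  rw [← sub_eq_iff_eq_add']
  simpa only [map_mul, map_sub, map_one, map_zero, NH.mk_NHx, NH.mk_NHd] using
    NH.mk_eq (NHRel.xd (k := k) i)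

theorem dg_mul_xg (i : DIdx N) :
    dg k N i * xg k N i.1 = xg k N i.succ * dg k N i + 1 := by
  rw [← sub_eq_iff_eq_add']
  simpa only [map_mul, map_sub, map_one, map_zero, NH.mk_NHx, NH.mk_NHd] using
    NH.mk_eq (NHRel.dx (k := k) i)

end NilHeckeRelations

/-- The commutation of `x₀` with `∂₁` follows from the braid relation and the remaining
relations. -/
theorem commute_of_nilHecke_relations {A : Type*} [Ring A] {x₀ x₁ x₂ d₀ d₁ : A}
    (h01 : x₀ * x₁ = x₁ * x₀) (h02 : x₀ * x₂ = x₂ * x₀)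
    (sq₀ : d₀ * d₀ = 0) (sq₁ : d₁ * d₁ = 0) (braid : d₀ * d₁ * d₀ = d₁ * d₀ * d₁)
    (hx₂ : x₂ * d₀ = d₀ * x₂)
    (xd₀ : x₀ * d₀ = d₀ * x₁ + 1) (dx₀ : d₀ * x₀ = x₁ * d₀ + 1)
    (xd₁ : x₁ * d₁ = d₁ * x₂ + 1) (dx₁ : d₁ * x₁ = x₂ * d₁ + 1) :
    Commute d₁ x₀ := by
  set c := x₀ * d₁ - d₁ * x₀ with hc
  have cx₁ : c * x₁ = x₂ * c := by
    linear_combination (norm := (rw [hc]; noncomm_ring)) x₀ * dx₁ - dx₁ * x₀ - d₁ * h01 + h02 * d₁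
  have cx₂ : c * x₂ = x₁ * c := by
    linear_combination (norm := (rw [hc]; noncomm_ring)) xd₁ * x₀ - x₀ * xd₁ - d₁ * h02 + h01 * d₁
  have cdd : c * d₀ * d₁ = 0 := by
    linear_combination (norm := (rw [hc]; noncomm_ring))
      xd₀ * d₁ * d₀ + d₀ * xd₁ * d₀ + d₀ * d₁ * hx₂ + sq₀ - x₀ * braid
        - d₁ * xd₀ * d₁ - d₁ * d₀ * xd₁ - sq₁ + braid * x₂
  have cd : c * d₀ = 0 := by
    linear_combination (norm := noncomm_ring)
      -(c * d₀ * dx₁) + cdd * x₁ + c * hx₂ * d₁ - cx₂ * d₀ * d₁ - x₁ * cdd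
  have c0 : c = 0 := by
    linear_combination (norm := noncomm_ring) -(c * dx₀) + cd * x₀ - cx₁ * d₀ - x₂ * cd
  exact (sub_eq_zero.mp c0).symm

section NilHeckeCommutation

variable {k} {N : ℕ}

theorem commute_dg_xg (i : DIdx N) (j : Fin N) (hj : j ≠ i.1) (hj' : j ≠ i.succ) :
    Commute (dg k N i) (xg k N j) := by
  have h1 : (j : ℕ) ≠ i.1 := fun h => hj (Fin.ext h)
  have h2 : (j : ℕ) ≠ (i.1 : ℕ) + 1 := fun h => hj' (Fin.ext h)
  by_cases h : (j : ℕ) + 1 = i.1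
  · have hi : (j : ℕ) + 1 < N := by omega
    have hs : DIdx.succ (⟨j, hi⟩ : DIdx N) = i.1 := Fin.ext h
    have xd := xg_mul_dg (k := k) (⟨j, hi⟩ : DIdx N)
    have dx := dg_mul_xg (k := k) (⟨j, hi⟩ : DIdx N)
    rw [hs] at xd dx
    exact commute_of_nilHecke_relations (xg_mul_comm _ _) (xg_mul_comm _ _) (dg_mul_self _)
      (dg_mul_self i) (dg_braid ⟨j, hi⟩ i h.symm)
      (xg_mul_dg_of_far i.succ ⟨j, hi⟩ (Or.inr (by simp; omega)))
      xd dx (xg_mul_dg i) (dg_mul_xg i)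
  · exact (xg_mul_dg_of_far j i (by omega)).symm

theorem commute_dg_xg_mul_xg (i : DIdx N) :
    Commute (dg k N i) (xg k N i.1 * xg k N i.succ) := by
  have h1 := xg_mul_dg (k := k) i
  have h2 := dg_mul_xg (k := k) i
  have h3 := xg_mul_comm (k := k) i.1 i.succ
  show _ = _
  linear_combination (norm := noncomm_ring) h2 * xg k N i.succ - xg k N i.succ * h1 - h3 * dg k N i

end NilHeckeCommutation

open scoped IsMulCommutative in
/-- A product of powers of commuting elements in which the exponent of `x i` exceeds that of `x j`
by one is `x i` times a monomial commuting with everything that commutes with `x i * x j` and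
the other `x l`. -/
theorem prod_ofFn_pow_eq_mul {A : Type*} [Monoid A] {n : ℕ} {x : Fin n → A}
    (hx : ∀ i j, x i * x j = x j * x i) {i j : Fin n} (hij : i ≠ j) {d : A}
    (hd : ∀ l, l ≠ i → l ≠ j → Commute d (x l)) (hdij : Commute d (x i * x j))
    {a b : Fin n → ℕ} (hi : a i = b i + 1) (hb : b i = b j) (hab : ∀ l, l ≠ i → a l = b l) :
    (List.ofFn fun l => x l ^ a l).prod = (List.ofFn fun l => x l ^ b l).prod * x i ∧
      Commute d (List.ofFn fun l => x l ^ b l).prod := by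
  let M := Submonoid.closure (Set.range x)
  have : IsMulCommutative M := Submonoid.isMulCommutative_closure _ (by
    rintro _ ⟨i, rfl⟩ _ ⟨j, rfl⟩
    exact hx i j)
  let y : Fin n → M := fun l => ⟨x l, Submonoid.subset_closure ⟨l, rfl⟩⟩
  have key (e : Fin n → ℕ) :
      (List.ofFn fun l => x l ^ e l).prod = ((∏ l, y l ^ e l : M) : A) := by
    rw [← List.prod_ofFn, ← M.coe_subtype, map_list_prod, List.map_ofFn]
    rfl
  rw [key, key]
  have hj : j ∈ Finset.univ.erase i := by simp [hij.symm]
  refine ⟨?_, ?_⟩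
  · have : ∏ l, y l ^ a l = (∏ l, y l ^ b l) * y i := by
      rw [← Finset.mul_prod_erase _ _ (Finset.mem_univ i),
        ← Finset.mul_prod_erase _ (fun l => y l ^ b l) (Finset.mem_univ i), hi, pow_succ,
        Finset.prod_congr rfl fun l hl => by rw [hab l (Finset.ne_of_mem_erase hl)],
        mul_right_comm]
    exact congrArg Subtype.val this
  · rw [← Finset.mul_prod_erase _ _ (Finset.mem_univ i), ← Finset.mul_prod_erase _ _ hj, ← hb,
      ← mul_assoc, ← mul_pow]
    refine Commute.mul_right (hdij.pow_right _) ?_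
    refine Finset.prod_induction _ (fun z : M => Commute d (z : A))
      (fun _ _ h h' => h.mul_right h') (Commute.one_right d) fun l hl => ?_
    simp only [Finset.mem_erase] at hl
    exact (hd l hl.2.1 hl.1).pow_right _

section Staircase

variable {k} {n : ℕ}

/-- If `D ∂_i = 0`, right multiplication by `∂_i` removes one factor `x_i` from a monomial whose
exponents at `i` and `i + 1` differ by one. -/
theorem mul_prod_xg_mul_dg {D : NH k n} {i : DIdx n} (hD : D * dg k n i = 0) {a b : Fin n → ℕ}
    (hi : a i.1 = b i.1 + 1) (hb : b i.1 = b i.succ) (hab : ∀ l, l ≠ i.1 → a l = b l) :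
    D * (List.ofFn fun l => xg k n l ^ a l).prod * dg k n i =
      D * (List.ofFn fun l => xg k n l ^ b l).prod := by
  have hne : i.1 ≠ i.succ := fun h => by simpa using congrArg Fin.val h
  obtain ⟨h, hc⟩ := prod_ofFn_pow_eq_mul (xg_mul_comm (k := k)) hne (commute_dg_xg i)
    (commute_dg_xg_mul_xg i) hi hb hab
  rw [h, mul_assoc, mul_assoc, xg_mul_dg, mul_add, mul_one, ← mul_assoc _ (dg k n i), ← hc.eq,
    mul_add, ← mul_assoc D, ← mul_assoc D, hD, zero_mul, zero_mul, zero_add]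

theorem IsDfam.revPerm_mul_dg {Dm : Equiv.Perm (Fin n) → NH k n} (hDm : IsDfam k n Dm)
    (i : DIdx n) : Dm Fin.revPerm * dg k n i = 0 := by
  have h := hDm.2 (Fin.revPerm * Equiv.swap i.1 i.succ) i (by
    simp [Fin.lt_def]; have := i.2; omega)
  rw [mul_assoc, Equiv.swap_mul_self, mul_one] at h
  rw [h, mul_assoc, dg_mul_self, mul_zero]

/-- One-line notation of the prefix of the reduced word
`(s_0 ⋯ s_{n-2}) (s_0 ⋯ s_{n-3}) ⋯ (s_0)` of `w₀` consisting of `p` complete parenthesised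
factors and `j` letters of the next one. -/
def stairPerm (n p j i : ℕ) : ℕ :=
  if i < j then p + 1 + i else if i = j then p else if i < n - p then p + i else n - 1 - i

/-- The number of positions `m > i` at which `stairPerm n p j` exceeds its value at `i`. -/
def stairExp (n p j i : ℕ) : ℕ :=
  if i < j then n - p - 2 - i else n - 1 - p - i

/-- Appending the letter `s_j` to the prefix underlying `stairPerm n p j`. -/
theorem IsDfam.stair_step {Dm : Equiv.Perm (Fin n) → NH k n} (hDm : IsDfam k n Dm)
    {p j : ℕ} (hj : p + (j + 1) < n) {X : NH k n}
    (h : ∃ w : Equiv.Perm (Fin n), (∀ i, (w i : ℕ) = stairPerm n p j i) ∧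
      Dm Fin.revPerm * X * Dm w =
        Dm Fin.revPerm * (List.ofFn fun i : Fin n => xg k n i ^ stairExp n p j i).prod) :
    ∃ w : Equiv.Perm (Fin n), (∀ i, (w i : ℕ) = stairPerm n p (j + 1) i) ∧
      Dm Fin.revPerm * X * Dm w =
        Dm Fin.revPerm * (List.ofFn fun i : Fin n => xg k n i ^ stairExp n p (j + 1) i).prod := by
  obtain ⟨w, hw, h⟩ := h
  let i : DIdx n := ⟨⟨j, by omega⟩, by simp; omega⟩
  refine ⟨w * Equiv.swap i.1 i.succ, fun l => ?_, ?_⟩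
  · rw [Equiv.Perm.mul_apply, hw, Equiv.swap_apply_def]
    simp only [i, Fin.ext_iff]
    unfold stairPerm
    split_ifs <;> simp_all <;> omega
  · rw [hDm.2 w i, ← mul_assoc, h]
    · refine mul_prod_xg_mul_dg (hDm.revPerm_mul_dg i) ?_ ?_ fun l hl => ?_
      · simp only [i, stairExp]
        split_ifs <;> omega
      · simp only [i, stairExp]
        split_ifs <;> omega
      · have hl : (l : ℕ) ≠ j := fun h => hl (Fin.ext h)
        simp only [stairExp]
        split_ifs <;> omega
    · rw [Fin.lt_def, hw, hw]
      simp only [i, stairPerm]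
      split_ifs <;> omega

/-- Right multiplication by the prefixes of the reduced word of `w₀` underlying `stairPerm` turns
the staircase monomial into the monomials with exponents `stairExp`. -/
theorem IsDfam.exists_stair {Dm : Equiv.Perm (Fin n) → NH k n} (hDm : IsDfam k n Dm)
    (p j : ℕ) (hj : p + j < n) :
    ∃ w : Equiv.Perm (Fin n), (∀ i, (w i : ℕ) = stairPerm n p j i) ∧
      Dm Fin.revPerm * (List.ofFn fun i : Fin n => xg k n i ^ (n - 1 - (i : ℕ))).prod * Dm w =
        Dm Fin.revPerm * (List.ofFn fun i : Fin n => xg k n i ^ stairExp n p j i).prod := by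
  induction p generalizing j with
  | zero =>
    induction j with
    | zero =>
      refine ⟨1, fun i => ?_, ?_⟩
      · have := i.2
        simp only [Equiv.Perm.one_apply, stairPerm]
        split_ifs <;> omega
      · simp [hDm.1, stairExp]
    | succ j ihj => exact hDm.stair_step hj (ihj (by omega))
  | succ p ihp =>
    induction j with
    | zero =>
      obtain ⟨w, hw, h⟩ := ihp (n - 1 - p) (by omega)
      refine ⟨w, fun i => ?_, ?_⟩
      · have := i.2
        rw [hw]
        unfold stairPerm
        split_ifs <;> omega
      · rw [h]
        congr 4
        funext i
        congr 1
        unfold stairExp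
        split_ifs <;> omega
    | succ j ihj => exact hDm.stair_step hj (ihj (by omega))

end Staircase

/-- for a field `k` and `n ≥ 1`, the element
`e_n = x_1^{n-1} x_2^{n-2} ⋯ x_{n-1} ∂_{w_0}` of the nilHecke algebra `NH_n` is an
idempotent. -/
theorem stmt_12 (n : ℕ) (hn : 1 ≤ n)
    (Dm : Equiv.Perm (Fin n) → NH k n) (hDm : IsDfam k n Dm) :
    eElt k n Dm * eElt k n Dm = eElt k n Dm := by
  obtain ⟨w, hw, h⟩ := hDm.exists_stair (n - 1) 0 (by omega)
  have hw : w = Fin.revPerm := by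
    ext i
    rw [hw, Fin.revPerm_apply, Fin.val_rev]
    unfold stairPerm
    split_ifs <;> omega
  have he : (List.ofFn fun i : Fin n => xg k n i ^ stairExp n (n - 1) 0 i).prod = 1 := by
    refine List.prod_eq_one fun z hz => ?_
    obtain ⟨i, rfl⟩ := List.mem_ofFn.mp hz
    have : stairExp n (n - 1) 0 i = 0 := by unfold stairExp; split_ifs <;> omega
    rw [this, pow_zero]
  rw [hw, he, mul_one] at h
  rw [eElt, mul_assoc, ← mul_assoc (Dm _), h]
end
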